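/- arXiv:2504.01944 — 2 statements merged into one kernel-verified Lean document; each statement's English description precedes it below -/
import Mathlib

section
/- Let (W,U) be a graphon game and f a strategy profile. Suppose {G_n = (I_n, A_n, v_n)} is a sequence of network games, {s_n} a sequence of strategy profiles, and {ε_n} a sequence of nonnegative reals such that: s_n is an ε_n-Nash equilibrium of G_n for every n; the sequence {G_n} converges to (W,U); f_{s_n}(t) → f(t) in norm for a.e. t ∈ (0,1]; and ε_n → 0. Then f is a Nash equilibrium of (W,U). -/
open MeasureTheory Set Filter Topology

noncomputable section

variable {E : Type*} [NormedAddCommGroup E] [NormedSpace ℝ E]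

/-- The common strategy set `S`, viewed as a subset of `E` with the weak topology. -/
def weakS (S : Set E) : Set (WeakSpace ℝ E) := toWeakSpace ℝ E '' S

/-- The Banach space `C` of real-valued functions on `S × S` that are continuous for the
weak topology of `S`, with the supremum norm. (Since `S` is weakly compact, these are
exactly the bounded continuous functions on `S × S` with the weak topology.) -/
abbrev CGame (S : Set E) := BoundedContinuousFunction (↥(weakS S) × ↥(weakS S)) ℝ

/-- An element of `S`, as a point of `S` with the weak topology. -/
def memWeakS {S : Set E} {a : E} (ha : a ∈ S) : ↥(weakS S) :=
  ⟨toWeakSpace ℝ E a, a, ha, rfl⟩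

/-- The agent space `(0,1]` with Lebesgue measure. -/
def μ01 : Measure ℝ := volume.restrict (Set.Ioc (0 : ℝ) 1)

/-- Lebesgue measure on `(0,1]²`. -/
def μ01sq : Measure (ℝ × ℝ) := volume.restrict ((Set.Ioc (0 : ℝ) 1) ×ˢ (Set.Ioc (0 : ℝ) 1))

/-- The local aggregate `∫ W(t,s) f(s) dμ(s)` of a strategy profile `f`. -/
def agg (W : ℝ → ℝ → ℝ) (f : ℝ → E) (t : ℝ) : E := ∫ s, W t s • f s ∂μ01

/-- `(W, U)` is a graphon game: `W` is a graphon on `(0,1]` and `U` is a measurable map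
from `(0,1]` to the closed unit ball `C₀` of `C`. -/
def IsGraphonGame (S : Set E) (W : ℝ → ℝ → ℝ) (U : ℝ → CGame S) : Prop :=
  Measurable (Function.uncurry W) ∧
  (∀ t ∈ Set.Ioc (0 : ℝ) 1, ∀ s ∈ Set.Ioc (0 : ℝ) 1, W t s ∈ Set.Icc (0 : ℝ) 1) ∧
  StronglyMeasurable U ∧ (∀ t, ‖U t‖ ≤ 1)

/-- A strategy profile of a graphon game: a measurable function from agents to `S`. -/
def IsProfile (S : Set E) (f : ℝ → E) : Prop :=
  StronglyMeasurable f ∧ ∀ t, f t ∈ S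

/-- `f` is a Nash equilibrium of the graphon game `(W, U)`: for a.e. agent `t`, `f t`
maximizes `a ↦ U t (a, agg W f t)` over `S`. (The membership facts `f t ∈ S` and
`agg W f t ∈ S`, which always hold for strategy profiles since `S` is closed convex and
contains `0`, are quantified universally so that the utility can be evaluated.) -/
def IsNashEq (S : Set E) (W : ℝ → ℝ → ℝ) (U : ℝ → CGame S) (f : ℝ → E) : Prop :=
  ∀ᵐ t ∂μ01, ∀ (hft : f t ∈ S) (hag : agg W f t ∈ S), ∀ a, ∀ ha : a ∈ S,
    U t (memWeakS ha, memWeakS hag) ≤ U t (memWeakS hft, memWeakS hag)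

/-- `f` is an `ε`-Nash equilibrium of the graphon game `(W, U)`: the set of agents whose
strategy is `ε`-optimal has measure at least `1 - ε`. -/
def IsEpsNashEq (S : Set E) (W : ℝ → ℝ → ℝ) (U : ℝ → CGame S) (f : ℝ → E) (ε : ℝ) : Prop :=
  ENNReal.ofReal (1 - ε) ≤
    μ01 {t : ℝ | ∀ (hft : f t ∈ S) (hag : agg W f t ∈ S), ∀ a, ∀ ha : a ∈ S,
      U t (memWeakS ha, memWeakS hag) - ε ≤ U t (memWeakS hft, memWeakS hag)}

/-- A network game with `m` players, common strategy set `S`, adjacency matrix `A` with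
entries in `[0,1]` and utility functions `v i` in the unit ball `C₀` of `C`. -/
def IsNetworkGame (S : Set E) (m : ℕ) (A : Fin m → Fin m → ℝ) (v : Fin m → CGame S) : Prop :=
  0 < m ∧ (∀ i j, A i j ∈ Set.Icc (0 : ℝ) 1) ∧ (∀ i, ‖v i‖ ≤ 1)

/-- The local aggregate `m⁻¹ Σ_j A i j • s j` of player `i` in a network game. -/
def netAgg (m : ℕ) (A : Fin m → Fin m → ℝ) (s : Fin m → E) (i : Fin m) : E :=
  (m : ℝ)⁻¹ • ∑ j, A i j • s j

/-- `s` is an `ε`-Nash equilibrium of the network game `(m, A, v)`: the proportion of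
players whose strategy is `ε`-optimal is at least `1 - ε`. -/
def IsNetEpsNashEq (S : Set E) (m : ℕ) (A : Fin m → Fin m → ℝ) (v : Fin m → CGame S)
    (s : Fin m → E) (ε : ℝ) : Prop :=
  1 - ε ≤ (({i : Fin m | ∀ (hsi : s i ∈ S) (hag : netAgg m A s i ∈ S), ∀ a, ∀ ha : a ∈ S,
      v i (memWeakS ha, memWeakS hag) - ε ≤ v i (memWeakS hsi, memWeakS hag)}.ncard : ℝ)) / m

/-- The `m`-step function on `(0,1]` determined by the values `g i` on the intervals
`(i/m, (i+1)/m]`, with default value `x₀` outside `(0,1]`. -/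
def stepOf {X : Type*} (m : ℕ) (g : Fin m → X) (x₀ : X) (t : ℝ) : X :=
  if h : ∃ i : Fin m, t ∈ Set.Ioc ((i : ℝ) / m) (((i : ℝ) + 1) / m) then g h.choose else x₀

/-- The `m`-step graphon `W_A` associated with the adjacency matrix `A`. -/
def stepGraphonOf (m : ℕ) (A : Fin m → Fin m → ℝ) : ℝ → ℝ → ℝ :=
  fun t s => stepOf m (fun i => stepOf m (fun j => A i j) 0 s) 0 t

/-- The `m`-step utility profile `U_v` associated with the utilities `v`. -/
def stepUtilOf {S : Set E} (m : ℕ) (v : Fin m → CGame S) : ℝ → CGame S := stepOf m v 0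

/-- The `m`-step strategy profile `f_s` associated with the strategies `s`. -/
def stepProfileOf (m : ℕ) (s : Fin m → E) : ℝ → E := stepOf m s 0

/-- A sequence of network games `(m n, A n, v n)` converges to the graphon game `(W, U)`:
`W_{A_n} → W` a.e. on `(0,1]²`, `U_{v_n}(t) → U(t)` in the norm of `C` for a.e. `t`, and
the number of players tends to infinity. -/
def NetGamesTendsto (S : Set E) (m : ℕ → ℕ) (A : ∀ n, Fin (m n) → Fin (m n) → ℝ)
    (v : ∀ n, Fin (m n) → CGame S) (W : ℝ → ℝ → ℝ) (U : ℝ → CGame S) : Prop :=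
  (∀ᵐ p ∂μ01sq, Tendsto (fun n => stepGraphonOf (m n) (A n) p.1 p.2) atTop (𝓝 (W p.1 p.2))) ∧
  (∀ᵐ t ∂μ01, Tendsto (fun n => stepUtilOf (m n) (v n) t) atTop (𝓝 (U t))) ∧
  Tendsto m atTop atTop

end

/-- A set that is compact for the weak topology is bounded in norm. -/
theorem exists_norm_le_of_isCompact_weakS {E : Type*} [NormedAddCommGroup E] [NormedSpace ℝ E]
    {S : Set E} (hS : IsCompact (weakS S)) : ∃ R, ∀ x ∈ S, ‖x‖ ≤ R := by
  have hpt : ∀ φ : StrongDual ℝ E,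
      ∃ C, ∀ x : S, ‖NormedSpace.inclusionInDoubleDual ℝ E x φ‖ ≤ C := by
    intro φ
    have hcont : Continuous fun y : WeakSpace ℝ E => φ ((toWeakSpace ℝ E).symm y) :=
      WeakBilin.eval_continuous (topDualPairing ℝ E).flip φ
    obtain ⟨C, hC⟩ := hS.exists_bound_of_continuousOn hcont.continuousOn
    exact ⟨C, fun x => by simpa using hC _ ⟨x, x.2, rfl⟩⟩
  obtain ⟨R, hR⟩ := banach_steinhaus hpt
  refine ⟨R, fun x hx => ?_⟩
  exact ((NormedSpace.inclusionInDoubleDualLi ℝ (E := E)).norm_map x).symm.le.trans (hR ⟨x, hx⟩)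

theorem tendsto_memWeakS {E : Type*} [NormedAddCommGroup E] [NormedSpace ℝ E] {S : Set E}
    {x : ℕ → E} {y : E} (hx : ∀ n, x n ∈ S) (hy : y ∈ S) (h : Tendsto x atTop (𝓝 y)) :
    Tendsto (fun n => memWeakS (hx n)) atTop (𝓝 (memWeakS hy)) := by
  rw [tendsto_subtype_rng]
  exact ((toWeakSpaceCLM ℝ E).continuous.tendsto y).comp h

theorem eq_of_mem_Ioc_div {m : ℕ} {i j : Fin m} {t : ℝ}
    (hi : t ∈ Ioc ((i : ℝ) / m) (((i : ℝ) + 1) / m))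
    (hj : t ∈ Ioc ((j : ℝ) / m) (((j : ℝ) + 1) / m)) : i = j := by
  have hm : (0 : ℝ) < m := by exact_mod_cast i.pos
  have h₁ := hi.1.trans_le hj.2
  have h₂ := hj.1.trans_le hi.2
  rw [div_lt_div_iff_of_pos_right hm] at h₁ h₂
  norm_cast at h₁ h₂
  exact Fin.ext (by omega)

theorem exists_mem_Ioc_div {m : ℕ} (hm : 0 < m) {t : ℝ} (ht : t ∈ Ioc (0 : ℝ) 1) :
    ∃ i : Fin m, t ∈ Ioc ((i : ℝ) / m) (((i : ℝ) + 1) / m) := by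
  have hm' : (0 : ℝ) < m := by exact_mod_cast hm
  have hpos : 0 < ⌈t * m⌉₊ := Nat.ceil_pos.2 (mul_pos ht.1 hm')
  have hle : ⌈t * m⌉₊ ≤ m := Nat.ceil_le.2 (by nlinarith [ht.2])
  have hcast : ((⌈t * m⌉₊ - 1 : ℕ) : ℝ) = (⌈t * m⌉₊ : ℝ) - 1 := by
    rw [Nat.cast_sub hpos, Nat.cast_one]
  refine ⟨⟨⌈t * m⌉₊ - 1, by omega⟩, ?_, ?_⟩
  · rw [div_lt_iff₀ hm']
    simp only [hcast]
    linarith [Nat.ceil_lt_add_one (mul_pos ht.1 hm').le]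
  · rw [le_div_iff₀ hm']
    simp only [hcast]
    linarith [Nat.le_ceil (t * m)]

theorem Ioc_div_subset {m : ℕ} (i : Fin m) :
    Ioc ((i : ℝ) / m) (((i : ℝ) + 1) / m) ⊆ Ioc (0 : ℝ) 1 := by
  have hm : (0 : ℝ) < m := by exact_mod_cast i.pos
  refine Ioc_subset_Ioc (by positivity) ?_
  rw [div_le_one hm]
  exact_mod_cast i.2

theorem μ01_Ioc_div {m : ℕ} (i : Fin m) :
    μ01 (Ioc ((i : ℝ) / m) (((i : ℝ) + 1) / m)) = ENNReal.ofReal ((m : ℝ)⁻¹) := by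
  rw [μ01, Measure.restrict_apply measurableSet_Ioc, inter_eq_left.2 (Ioc_div_subset i),
    Real.volume_Ioc]
  congr 1
  ring

instance : IsFiniteMeasure μ01 := by
  unfold μ01
  infer_instance

theorem stepOf_eq {X : Type*} {m : ℕ} (g : Fin m → X) (x₀ : X) {i : Fin m} {t : ℝ}
    (hi : t ∈ Ioc ((i : ℝ) / m) (((i : ℝ) + 1) / m)) : stepOf m g x₀ t = g i := by
  have h : ∃ i : Fin m, t ∈ Ioc ((i : ℝ) / m) (((i : ℝ) + 1) / m) := ⟨i, hi⟩
  rw [stepOf, dif_pos h, eq_of_mem_Ioc_div h.choose_spec hi]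

theorem stepOf_zero_eq_sum {X : Type*} [AddCommMonoid X] {m : ℕ} (g : Fin m → X) :
    stepOf m g 0 =
      fun t => ∑ j : Fin m, (Ioc ((j : ℝ) / m) (((j : ℝ) + 1) / m)).indicator (fun _ => g j) t := by
  funext t
  by_cases h : ∃ i : Fin m, t ∈ Ioc ((i : ℝ) / m) (((i : ℝ) + 1) / m)
  · obtain ⟨i, hi⟩ := h
    rw [stepOf_eq g 0 hi, Finset.sum_eq_single i, indicator_of_mem hi]
    · intro j _ hji
      exact indicator_of_notMem (fun hj => hji (eq_of_mem_Ioc_div hj hi)) _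
    · simp
  · rw [stepOf, dif_neg h]
    push Not at h
    exact (Finset.sum_eq_zero fun j _ => indicator_of_notMem (h j) _).symm

theorem stronglyMeasurable_stepOf_zero {X : Type*} [NormedAddCommGroup X] {m : ℕ}
    (g : Fin m → X) : StronglyMeasurable (stepOf m g 0) := by
  rw [stepOf_zero_eq_sum]
  exact Finset.stronglyMeasurable_fun_sum _ fun j _ =>
    stronglyMeasurable_const.indicator measurableSet_Ioc

theorem integral_stepOf_zero {X : Type*} [NormedAddCommGroup X] [NormedSpace ℝ X]
    [CompleteSpace X] {m : ℕ} (g : Fin m → X) :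
    ∫ t, stepOf m g 0 t ∂μ01 = (m : ℝ)⁻¹ • ∑ j, g j := by
  rw [stepOf_zero_eq_sum, integral_finsetSum, Finset.smul_sum]
  · refine Finset.sum_congr rfl fun j _ => ?_
    rw [integral_indicator_const _ measurableSet_Ioc, measureReal_def, μ01_Ioc_div,
      ENNReal.toReal_ofReal (by positivity)]
  · exact fun j _ => (integrable_const _).indicator measurableSet_Ioc

/-- The aggregate of the step representations at an agent of the `i`-th interval is the
aggregate of player `i`. -/
theorem agg_stepGraphonOf {E : Type*} [NormedAddCommGroup E] [NormedSpace ℝ E] [CompleteSpace E]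
    {m : ℕ} (A : Fin m → Fin m → ℝ) (s : Fin m → E) {i : Fin m} {t : ℝ}
    (hi : t ∈ Ioc ((i : ℝ) / m) (((i : ℝ) + 1) / m)) :
    agg (stepGraphonOf m A) (stepProfileOf m s) t = netAgg m A s i := by
  rw [netAgg, ← integral_stepOf_zero, agg]
  refine setIntegral_congr_fun measurableSet_Ioc fun r hr => ?_
  obtain ⟨j, hj⟩ := exists_mem_Ioc_div i.pos hr
  simp only [stepGraphonOf, stepProfileOf, stepOf_eq _ _ hi, stepOf_eq _ _ hj]

theorem netAgg_mem {E : Type*} [NormedAddCommGroup E] [NormedSpace ℝ E] {S : Set E}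
    (hS0 : (0 : E) ∈ S) (hSconv : Convex ℝ S) {m : ℕ} {A : Fin m → Fin m → ℝ}
    (hA : ∀ i j, A i j ∈ Icc (0 : ℝ) 1) {s : Fin m → E} (hs : ∀ i, s i ∈ S) (i : Fin m) :
    netAgg m A s i ∈ S := by
  have hm : (m : ℝ) ≠ 0 := by exact_mod_cast i.pos.ne'
  have hmem : ∑ j, (m : ℝ)⁻¹ • (A i j • s j) ∈ S := by
    refine hSconv.sum_mem (fun _ _ => by positivity) (by simp [hm]) fun j _ => ?_
    exact hSconv.smul_mem_of_zero_mem hS0 (hs j) (hA i j)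
  rwa [← Finset.smul_sum] at hmem

theorem norm_stepOf_zero_le {X : Type*} [NormedAddCommGroup X] {m : ℕ} {g : Fin m → X} {R : ℝ}
    (hR : 0 ≤ R) (hg : ∀ i, ‖g i‖ ≤ R) (t : ℝ) : ‖stepOf m g 0 t‖ ≤ R := by
  unfold stepOf
  split_ifs
  · exact hg _
  · simpa using hR

theorem stronglyMeasurable_stepGraphonOf {m : ℕ} (A : Fin m → Fin m → ℝ) (t : ℝ) :
    StronglyMeasurable (stepGraphonOf m A t) := by
  by_cases h : ∃ i : Fin m, t ∈ Ioc ((i : ℝ) / m) (((i : ℝ) + 1) / m)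
  · obtain ⟨i, hi⟩ := h
    have : stepGraphonOf m A t = stepOf m (fun j => A i j) 0 := by
      funext r
      exact stepOf_eq _ _ hi
    rw [this]
    exact stronglyMeasurable_stepOf_zero _
  · have : stepGraphonOf m A t = fun _ => 0 := by
      funext r
      exact dif_neg h
    rw [this]
    exact stronglyMeasurable_const

/-- Local aggregates converge in norm at almost every agent. -/
theorem ae_tendsto_agg_step {E : Type*} [NormedAddCommGroup E] [NormedSpace ℝ E]
    {m : ℕ → ℕ} {A : ∀ n, Fin (m n) → Fin (m n) → ℝ} {s : ∀ n, Fin (m n) → E}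
    {W : ℝ → ℝ → ℝ} {f : ℝ → E} {R : ℝ} (hR : 0 ≤ R)
    (hA : ∀ n i j, A n i j ∈ Icc (0 : ℝ) 1) (hs : ∀ n i, ‖s n i‖ ≤ R)
    (hW : ∀ᵐ p ∂μ01sq,
      Tendsto (fun n => stepGraphonOf (m n) (A n) p.1 p.2) atTop (𝓝 (W p.1 p.2)))
    (hf : ∀ᵐ t ∂μ01, Tendsto (fun n => stepProfileOf (m n) (s n) t) atTop (𝓝 (f t))) :
    ∀ᵐ t ∂μ01, Tendsto (fun n => agg (stepGraphonOf (m n) (A n)) (stepProfileOf (m n) (s n)) t)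
      atTop (𝓝 (agg W f t)) := by
  have hprod : μ01sq = μ01.prod μ01 := by
    rw [μ01sq, μ01, Measure.prod_restrict, ← Measure.volume_eq_prod]
  rw [hprod] at hW
  filter_upwards [Measure.ae_ae_of_ae_prod hW] with t ht
  refine tendsto_integral_of_dominated_convergence (fun _ => R) (fun n => ?_)
    (integrable_const _) (fun n => ?_) ?_
  · exact ((stronglyMeasurable_stepGraphonOf (A n) t).smul
      (stronglyMeasurable_stepOf_zero (s n))).aestronglyMeasurable
  · refine Eventually.of_forall fun r => ?_
    rw [norm_smul]
    have h₁ : ‖stepGraphonOf (m n) (A n) t r‖ ≤ 1 := by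
      refine norm_stepOf_zero_le zero_le_one (fun i => ?_) t
      refine norm_stepOf_zero_le zero_le_one (fun j => ?_) r
      rw [Real.norm_of_nonneg (hA n i j).1]
      exact (hA n i j).2
    have h₂ : ‖stepProfileOf (m n) (s n) r‖ ≤ R := norm_stepOf_zero_le hR (hs n) r
    simpa using mul_le_mul h₁ h₂ (norm_nonneg _) zero_le_one
  · filter_upwards [ht, hf] with r hr hfr using hr.smul hfr

theorem μ01_iUnion_Ioc_div_le {m : ℕ} (hm : 0 < m) (p : Set (Fin m)) {ε : ℝ}
    (hp : 1 - ε ≤ (p.ncard : ℝ) / m) :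
    μ01 (⋃ i ∈ pᶜ, Ioc ((i : ℝ) / m) (((i : ℝ) + 1) / m)) ≤ ENNReal.ofReal ε := by
  classical
  have hm' : (0 : ℝ) < m := by exact_mod_cast hm
  have hcard : (p.ncard : ℝ) + (pᶜ.ncard : ℝ) = m := by
    exact_mod_cast (by simpa using Set.ncard_add_ncard_compl p)
  have hle : (pᶜ.ncard : ℝ) * (m : ℝ)⁻¹ ≤ ε := by
    rw [← div_eq_mul_inv, div_le_iff₀ hm']
    rw [le_div_iff₀ hm'] at hp
    linarith
  calc μ01 (⋃ i ∈ pᶜ, Ioc ((i : ℝ) / m) (((i : ℝ) + 1) / m))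
      = μ01 (⋃ i ∈ pᶜ.toFinset, Ioc ((i : ℝ) / m) (((i : ℝ) + 1) / m)) := by
        simp only [mem_toFinset]
    _ ≤ ∑ i ∈ pᶜ.toFinset, μ01 (Ioc ((i : ℝ) / m) (((i : ℝ) + 1) / m)) :=
        measure_biUnion_finset_le _ _
    _ = ENNReal.ofReal ((pᶜ.ncard : ℝ) * (m : ℝ)⁻¹) := by
        simp only [μ01_Ioc_div, Finset.sum_const, nsmul_eq_mul]
        rw [ENNReal.ofReal_mul (by positivity), ENNReal.ofReal_natCast,
          Set.ncard_eq_toFinset_card']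
    _ ≤ ENNReal.ofReal ε := ENNReal.ofReal_le_ofReal hle

/-- If the measures of the sets `B n` tend to zero, then almost every point lies outside
infinitely many of them. -/
theorem ae_frequently_notMem_of_tendsto_measure {α : Type*} {mα : MeasurableSpace α}
    {μ : Measure α} {B : ℕ → Set α} (h : Tendsto (fun n => μ (B n)) atTop (𝓝 0)) :
    ∀ᵐ x ∂μ, ∃ᶠ n in atTop, x ∉ B n := by
  have hnull : ∀ N, μ {x | ∀ n ≥ N, x ∈ B n} = 0 := fun N =>
    le_antisymm (ge_of_tendsto h ((eventually_ge_atTop N).mono fun n hn =>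
      measure_mono fun x hx => hx n hn)) zero_le
  filter_upwards [ae_all_iff.2 fun N => measure_eq_zero_iff_ae_notMem.1 (hnull N)] with x hx
  rw [Filter.frequently_atTop]
  intro N
  by_contra! hN
  exact hx N hN

/-- **Limits of asymptotic Nash equilibria of large network games are Nash equilibria**
(Corollary 3 of the paper). If a sequence of network games converges to a graphon game
`(W, U)` and `s_n` are asymptotic Nash equilibria whose step representations converge
a.e. to `f`, then `f` is a Nash equilibrium of `(W, U)`. -/
theorem limit_of_network_asymptotic_nash_is_nash
    {E : Type*} [NormedAddCommGroup E] [NormedSpace ℝ E] [CompleteSpace E]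
    [TopologicalSpace.SeparableSpace E]
    (S : Set E) (hS0 : (0 : E) ∈ S) (hSconv : Convex ℝ S) (hScomp : IsCompact (weakS S))
    (W : ℝ → ℝ → ℝ) (U : ℝ → CGame S) (hG : IsGraphonGame S W U)
    (f : ℝ → E) (hf : IsProfile S f)
    (m : ℕ → ℕ) (A : ∀ n, Fin (m n) → Fin (m n) → ℝ) (v : ∀ n, Fin (m n) → CGame S)
    (hnet : ∀ n, IsNetworkGame S (m n) (A n) (v n))
    (s : ∀ n, Fin (m n) → E) (hs : ∀ n i, s n i ∈ S)
    (ε : ℕ → ℝ) (hεnonneg : ∀ n, 0 ≤ ε n)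
    (hNash : ∀ n, IsNetEpsNashEq S (m n) (A n) (v n) (s n) (ε n))
    (hconv : NetGamesTendsto S m A v W U)
    (hfconv : ∀ᵐ t ∂μ01, Tendsto (fun n => stepProfileOf (m n) (s n) t) atTop (𝓝 (f t)))
    (hεconv : Tendsto ε atTop (𝓝 0)) :
    IsNashEq S W U f := by
  obtain ⟨hW, hU, -⟩ := hconv
  obtain ⟨R, hR⟩ := exists_norm_le_of_isCompact_weakS hScomp
  have hR0 : 0 ≤ R := (norm_nonneg _).trans (hR 0 hS0)
  have hagg := ae_tendsto_agg_step hR0 (fun n => (hnet n).2.1) (fun n i => hR _ (hs n i)) hW hfconv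
  set p : ∀ n, Set (Fin (m n)) := fun n =>
    {i | ∀ (hsi : s n i ∈ S) (hag : netAgg (m n) (A n) (s n) i ∈ S), ∀ a, ∀ ha : a ∈ S,
      v n i (memWeakS ha, memWeakS hag) - ε n ≤ v n i (memWeakS hsi, memWeakS hag)}
  have hbad : Tendsto (fun n => μ01 (⋃ i ∈ (p n)ᶜ,
      Ioc ((i : ℝ) / (m n : ℝ)) (((i : ℝ) + 1) / (m n : ℝ)))) atTop (𝓝 0) := by
    refine tendsto_of_tendsto_of_tendsto_of_le_of_le tendsto_const_nhds
      (by simpa using ENNReal.tendsto_ofReal hεconv) (fun _ => zero_le) fun n => ?_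
    exact μ01_iUnion_Ioc_div_le (hnet n).1 (p n) (hNash n)
  have hmem : ∀ᵐ t ∂μ01, t ∈ Ioc (0 : ℝ) 1 := ae_restrict_mem measurableSet_Ioc
  filter_upwards [hmem, hU, hfconv, hagg, ae_frequently_notMem_of_tendsto_measure hbad]
    with t ht hUt hft haggt hfreq hfS hag a ha
  choose i hi using fun n => exists_mem_Ioc_div (hnet n).1 ht
  simp only [stepUtilOf, stepProfileOf, fun n => stepOf_eq (v n) 0 (hi n),
    fun n => stepOf_eq (s n) 0 (hi n)] at hUt hft
  simp only [fun n => agg_stepGraphonOf (A n) (s n) (hi n)] at haggt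
  have haggS : ∀ n, netAgg (m n) (A n) (s n) (i n) ∈ S := fun n =>
    netAgg_mem hS0 hSconv (hnet n).2.1 (hs n) (i n)
  have heval : ∀ {x : ℕ → ↥(weakS S)} {y : ↥(weakS S)}, Tendsto x atTop (𝓝 y) →
      Tendsto (fun n => v n (i n) (x n, memWeakS (haggS n))) atTop
        (𝓝 (U t (y, memWeakS hag))) := fun hx =>
    (ContinuousEval.continuous_eval.tendsto (_, _)).comp
      (hUt.prodMk_nhds (hx.prodMk_nhds (tendsto_memWeakS haggS hag haggt)))
  have hleft := (heval (tendsto_const_nhds (x := memWeakS ha))).sub hεconv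
  rw [sub_zero] at hleft
  refine le_of_tendsto_of_tendsto_of_frequently hleft
    (heval (tendsto_memWeakS (fun n => hs n (i n)) hfS hft)) (hfreq.mono fun n hn => ?_)
  have hin : i n ∈ p n := by
    by_contra hnot
    exact hn (mem_iUnion₂.2 ⟨i n, hnot, hi n⟩)
  exact hin (hs n (i n)) (haggS n) a ha
end

section
/- Assume (A1)–(A6). Let 𝒮¹_S ⊆ L¹(μ,E) denote the set of (equivalence classes of) Bochner integrable selections of S, define 𝕎(t,g) = ∫ W(t,s) g(s) dμ(s) for g ∈ L¹(μ,E) and t ∈ T, and define B(t,e) = argmax_{a∈S(t)} U(t,a,e). If {f_n} and {g_n} are sequences in 𝒮¹_S with f_n → f and g_n → g in the weak topology of L¹(μ,E), where f, g ∈ 𝒮¹_S, and for every n, f_n(t) ∈ B(t, 𝕎(t,g_n)) for a.e. t ∈ T, then f(t) ∈ B(t, 𝕎(t,g)) for a.e. t ∈ T. -/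
open MeasureTheory Set Filter Topology

/-- **Mazur's lemma**: a weak limit of a sequence is a norm limit of convex combinations of its
tails. -/
theorem exists_tendsto_mem_convexHull_of_tendsto_weakSpace
    {F : Type*} [NormedAddCommGroup F] [NormedSpace ℝ F] {u : ℕ → F} {x : F}
    (h : Tendsto (fun n => toWeakSpace ℝ F (u n)) atTop (𝓝 (toWeakSpace ℝ F x))) :
    ∃ v : ℕ → F, (∀ m, v m ∈ convexHull ℝ (u '' Ici m)) ∧ Tendsto v atTop (𝓝 x) := by
  have key : ∀ m : ℕ, ∃ v ∈ convexHull ℝ (u '' Ici m), dist x v < 1 / ((m : ℝ) + 1) := by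
    intro m
    have hweak : toWeakSpace ℝ F x ∈
        closure (toWeakSpace ℝ F '' convexHull ℝ (u '' Ici m)) := by
      refine mem_closure_of_tendsto h ?_
      filter_upwards [eventually_ge_atTop m] with n hn
      exact mem_image_of_mem _ (subset_convexHull ℝ _ (mem_image_of_mem _ hn))
    rw [← (convex_convexHull ℝ (u '' Ici m)).toWeakSpace_closure ℝ] at hweak
    obtain ⟨y, hy, hyx⟩ := hweak
    rw [(toWeakSpace ℝ F).injective hyx] at hy
    exact Metric.mem_closure_iff.1 hy _ (by positivity)
  choose v hv hvx using key
  refine ⟨v, hv, tendsto_iff_dist_tendsto_zero.2 ?_⟩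
  refine squeeze_zero (fun _ => dist_nonneg) (fun m => ?_)
    (tendsto_one_div_add_atTop_nhds_zero_nat (𝕜 := ℝ))
  rw [dist_comm]
  exact (hvx m).le

/-- A convex combination in `Lᵖ` is almost everywhere the pointwise convex combination. -/
theorem ae_mem_convexHull_of_mem_convexHull_Lp
    {T E ι : Type*} [MeasurableSpace T] {μ : Measure T} [NormedAddCommGroup E] [NormedSpace ℝ E]
    {p : ENNReal} {u : ι → Lp E p μ} {w : ι → T → E} {I : Set ι}
    (hu : ∀ i ∈ I, u i =ᵐ[μ] w i) {v : Lp E p μ} (hv : v ∈ convexHull ℝ (u '' I)) :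
    ∀ᵐ t ∂μ, v t ∈ convexHull ℝ ((fun i => w i t) '' I) := by
  have hconv : Convex ℝ {v : Lp E p μ |
      ∀ᵐ t ∂μ, v t ∈ convexHull ℝ ((fun i => w i t) '' I)} := by
    intro x hx y hy a b ha hb hab
    filter_upwards [hx, hy, Lp.coeFn_add (a • x) (b • y), Lp.coeFn_smul a x,
      Lp.coeFn_smul b y] with t hxt hyt h1 h2 h3
    rw [h1, Pi.add_apply, h2, h3]
    exact convex_convexHull ℝ _ hxt hyt ha hb hab
  refine convexHull_min ?_ hconv hv
  rintro _ ⟨i, hi, rfl⟩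
  filter_upwards [hu i hi] with t ht
  rw [ht]
  exact subset_convexHull ℝ _ (mem_image_of_mem _ hi)

/-- A weak limit in `L¹` is almost everywhere a limit of convex combinations of the values of
the tails, along a subsequence. -/
theorem ae_exists_tendsto_convexHull_of_tendsto_weakSpace_L1
    {T E : Type*} [MeasurableSpace T] {μ : Measure T} [NormedAddCommGroup E] [NormedSpace ℝ E]
    {f : T → E} {fn : ℕ → T → E} (hf : Integrable f μ) (hfn : ∀ n, Integrable (fn n) μ)
    (h : Tendsto (fun n => toWeakSpace ℝ (Lp E 1 μ) ((hfn n).toL1 (fn n))) atTop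
      (𝓝 (toWeakSpace ℝ (Lp E 1 μ) (hf.toL1 f)))) :
    ∀ᵐ t ∂μ, ∃ v : ℕ → E, (∀ m, v m ∈ convexHull ℝ ((fun n => fn n t) '' Ici m)) ∧
      Tendsto v atTop (𝓝 (f t)) := by
  obtain ⟨v, hv, hvf⟩ := exists_tendsto_mem_convexHull_of_tendsto_weakSpace h
  obtain ⟨ns, hns, hae⟩ := (tendstoInMeasure_of_tendsto_Lp hvf).exists_seq_tendsto_ae
  have hmem : ∀ᵐ t ∂μ, ∀ m, v m t ∈ convexHull ℝ ((fun n => fn n t) '' Ici m) :=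
    ae_all_iff.2 fun m =>
      ae_mem_convexHull_of_mem_convexHull_Lp (fun n _ => (hfn n).coeFn_toL1) (hv m)
  filter_upwards [hae, hmem, hf.coeFn_toL1] with t ht hmt hft
  refine ⟨fun m => v (ns m) t, fun m => ?_, by rwa [← hft]⟩
  exact convexHull_mono (image_mono (Ici_subset_Ici.2 (hns.id_le m))) (hmt (ns m))

/-- Integration against a bounded measurable weight is weakly continuous on `L¹`. -/
theorem tendsto_weakSpace_integral_smul
    {T E : Type*} [MeasurableSpace T] {μ : Measure T} [NormedAddCommGroup E] [NormedSpace ℝ E]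
    [CompleteSpace E] {k : T → ℝ} (hk : Measurable k) (hk01 : ∀ s, k s ∈ Icc (0 : ℝ) 1)
    {g : T → E} {gn : ℕ → T → E} (hg : Integrable g μ) (hgn : ∀ n, Integrable (gn n) μ)
    (h : Tendsto (fun n => toWeakSpace ℝ (Lp E 1 μ) ((hgn n).toL1 (gn n))) atTop
      (𝓝 (toWeakSpace ℝ (Lp E 1 μ) (hg.toL1 g)))) :
    Tendsto (fun n => toWeakSpace ℝ E (∫ s, k s • gn n s ∂μ)) atTop
      (𝓝 (toWeakSpace ℝ E (∫ s, k s • g s ∂μ))) := by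
  have hbound : ∀ s, ‖k s‖ ≤ 1 := fun s => by
    rw [Real.norm_of_nonneg (hk01 s).1]
    exact (hk01 s).2
  have hint : ∀ v : T → E, Integrable v μ → Integrable (fun s => k s • v s) μ := fun v hv =>
    hv.bdd_smul 1 hk.aestronglyMeasurable (Eventually.of_forall hbound)
  let L : Lp E 1 μ →ₗ[ℝ] E :=
    { toFun := fun v => ∫ s, k s • v s ∂μ
      map_add' := fun v w => by
        rw [← integral_add (hint v (L1.integrable_coeFn v)) (hint w (L1.integrable_coeFn w))]
        refine integral_congr_ae ?_
        filter_upwards [Lp.coeFn_add v w] with s hs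
        rw [hs, Pi.add_apply, smul_add]
      map_smul' := fun c v => by
        rw [RingHom.id_apply, ← integral_smul]
        refine integral_congr_ae ?_
        filter_upwards [Lp.coeFn_smul c v] with s hs
        rw [hs, Pi.smul_apply, smul_comm] }
  have hLbound : ∀ v, ‖L v‖ ≤ 1 * ‖v‖ := fun v => by
    rw [one_mul, L1.norm_eq_integral_norm]
    refine norm_integral_le_of_norm_le (L1.integrable_coeFn v).norm (Eventually.of_forall ?_)
    intro s
    rw [norm_smul]
    exact mul_le_of_le_one_left (norm_nonneg _) (hbound s)
  let K : Lp E 1 μ →L[ℝ] E := L.mkContinuous 1 hLbound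
  have hK : ∀ v (hv : Integrable v μ), K (hv.toL1 v) = ∫ s, k s • v s ∂μ := fun v hv => by
    refine integral_congr_ae ?_
    filter_upwards [hv.coeFn_toL1] with s hs
    rw [hs]
  have hlim := ((WeakSpace.map K).continuous.tendsto _).comp h
  rw [← hK g hg]
  simp_rw [← fun n => hK (gn n) (hgn n)]
  exact hlim

/-- The maximizers of a quasiconcave function on a set form a convex set. -/
theorem QuasiconcaveOn.convex_argmax {E : Type*} [AddCommGroup E] [Module ℝ E] {S : Set E}
    {u : E → ℝ} (h : QuasiconcaveOn ℝ S u) (hS : Convex ℝ S) :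
    Convex ℝ {a ∈ S | ∀ b ∈ S, u b ≤ u a} :=
  fun _ hx _ hy _ _ ha hb hab => ⟨hS hx.1 hy.1 ha hb hab, fun b hbS =>
    (h (u b) ⟨hx.1, hx.2 b hbS⟩ ⟨hy.1, hy.2 b hbS⟩ ha hb hab).2⟩

/-- Limits of convex combinations of maximizers of `V · (e n)` over a convex weakly compact set
are maximizers of `V · e∞` when `e n` converges weakly to `e∞`. -/
theorem mem_argmax_of_tendsto_convexHull
    {E : Type*} [NormedAddCommGroup E] [NormedSpace ℝ E] {S : Set E} {V : E → E → ℝ}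
    (hSconv : Convex ℝ S) (hScomp : IsCompact (toWeakSpace ℝ E '' S))
    (hVcont : ContinuousOn
      (fun p : WeakSpace ℝ E × WeakSpace ℝ E =>
        V ((toWeakSpace ℝ E).symm p.1) ((toWeakSpace ℝ E).symm p.2))
      ((toWeakSpace ℝ E '' S) ×ˢ (univ : Set (WeakSpace ℝ E))))
    {x : ℕ → E} {y : E} {e : ℕ → E} {e' : E}
    (hVqc : QuasiconcaveOn ℝ S (fun a => V a e'))
    (he : Tendsto (fun n => toWeakSpace ℝ E (e n)) atTop (𝓝 (toWeakSpace ℝ E e')))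
    (hx : ∀ n, x n ∈ S ∧ ∀ a ∈ S, V a (e n) ≤ V (x n) (e n))
    {v : ℕ → E} (hv : ∀ m, v m ∈ convexHull ℝ (x '' Ici m)) (hvy : Tendsto v atTop (𝓝 y)) :
    y ∈ S ∧ ∀ a ∈ S, V a e' ≤ V y e' := by
  have hlim : ∀ {l : Filter ℕ} {z : ℕ → E} {a : E} {d : ℕ → E}, (∀ n, z n ∈ S) → a ∈ S →
      Tendsto (fun n => toWeakSpace ℝ E (z n)) l (𝓝 (toWeakSpace ℝ E a)) →
      Tendsto (fun n => toWeakSpace ℝ E (d n)) l (𝓝 (toWeakSpace ℝ E e')) →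
      Tendsto (fun n => V (z n) (d n)) l (𝓝 (V a e')) := by
    intro l z a d hz ha hza hd
    have hc := hVcont (toWeakSpace ℝ E a, toWeakSpace ℝ E e')
      ⟨mem_image_of_mem _ ha, mem_univ _⟩
    have hp : Tendsto (fun n => (toWeakSpace ℝ E (z n), toWeakSpace ℝ E (d n))) l
        (𝓝[(toWeakSpace ℝ E '' S) ×ˢ (univ : Set (WeakSpace ℝ E))]
          (toWeakSpace ℝ E a, toWeakSpace ℝ E e')) :=
      tendsto_nhdsWithin_iff.2 ⟨hza.prodMk_nhds hd,
        Eventually.of_forall fun n => ⟨mem_image_of_mem _ (hz n), mem_univ _⟩⟩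
    simpa [Function.comp_def] using hc.tendsto.comp hp
  have hweak : Continuous (toWeakSpace ℝ E) := (toWeakSpaceCLM ℝ E).continuous
  have hSclosed : IsClosed S := by
    have := hScomp.isClosed.preimage hweak
    rwa [preimage_image_eq _ (toWeakSpace ℝ E).injective] at this
  set B : Set E := {a ∈ S | ∀ b ∈ S, V b e' ≤ V a e'} with hB
  have hBclosed : IsClosed B := by
    refine IsSeqClosed.isClosed fun z a hz hza => ?_
    have ha : a ∈ S := hSclosed.mem_of_tendsto hza (Eventually.of_forall fun n => (hz n).1)
    exact ⟨ha, fun b hb => ge_of_tendsto'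
      (hlim (fun n => (hz n).1) ha ((hweak.tendsto a).comp hza) tendsto_const_nhds)
      fun n => (hz n).2 b hb⟩
  by_contra hy
  obtain ⟨φ, α, hφB, hφy⟩ :=
    geometric_hahn_banach_closed_point (hVqc.convex_argmax hSconv) hBclosed (x := y) hy
  have hfreq : ∃ᶠ n in atTop, α < φ (x n) := by
    intro hev
    obtain ⟨N, hN⟩ := eventually_atTop.1 hev
    refine hφy.not_ge (le_of_tendsto ((φ.continuous.tendsto y).comp hvy) ?_)
    filter_upwards [eventually_ge_atTop N] with m hm
    refine convexHull_min ?_ (convex_halfSpace_le φ.isLinear α) (hv m)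
    rintro _ ⟨n, hn, rfl⟩
    exact not_lt.1 (hN n (hm.trans hn))
  have hne : (atTop ⊓ 𝓟 {n | α < φ (x n)}).NeBot := frequently_mem_iff_neBot.1 hfreq
  let l : Ultrafilter ℕ := Ultrafilter.of (atTop ⊓ 𝓟 {n | α < φ (x n)})
  have hl : (l : Filter ℕ) ≤ atTop ⊓ 𝓟 {n | α < φ (x n)} := Ultrafilter.of_le _
  obtain ⟨_, ⟨a, ha, rfl⟩, hla⟩ := isCompact_iff_ultrafilter_le_nhds.1 hScomp
    (l.map fun n => toWeakSpace ℝ E (x n))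
    (tendsto_principal.2 (Eventually.of_forall fun n => mem_image_of_mem _ (hx n).1))
  have hxa : Tendsto (fun n => toWeakSpace ℝ E (x n)) l (𝓝 (toWeakSpace ℝ E a)) := hla
  have hel := he.mono_left (hl.trans inf_le_left)
  have haB : a ∈ B := ⟨ha, fun b hb => le_of_tendsto_of_tendsto'
    (hlim (fun _ => hb) hb tendsto_const_nhds hel) (hlim (fun n => (hx n).1) ha hxa hel)
    fun n => (hx n).2 b hb⟩
  have hφa : Tendsto (fun n => φ (x n)) l (𝓝 (φ a)) :=
    ((WeakBilin.eval_continuous (topDualPairing ℝ E).flip φ).tendsto (toWeakSpace ℝ E a)).comp hxa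
  have hle : α ≤ φ a := ge_of_tendsto hφa (by
    filter_upwards [(hl.trans inf_le_right) (mem_principal_self _)] with n hn using hn.le)
  exact (hφB a haB).not_ge hle

/-- **Closedness of the best-response map along weakly convergent sequences in `L¹(μ,E)`**
(Lemma 7 of the paper, key step in the proof of the existence theorem). Under
assumptions (A1)–(A6), if `f_n → f` and `g_n → g` weakly in `L¹(μ,E)`, all being
integrable selections of `S`, and for every `n`, `f_n(t)` is a best response to the
local aggregate `𝕎(t, g_n) = ∫ W(t,s) gₙ(s) dμ(s)` for a.e. `t`, then `f(t)` is a best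
response to `𝕎(t, g)` for a.e. `t`. -/
theorem best_response_weakly_closed
    {E : Type*} [NormedAddCommGroup E] [NormedSpace ℝ E] [CompleteSpace E]
    [TopologicalSpace.SeparableSpace E] [MeasurableSpace E] [BorelSpace E]
    {T : Type*} [MeasurableSpace T] (μ : Measure T) [IsFiniteMeasure μ]
    (hμcomplete : μ.IsComplete)
    -- (A1) `(T, Σ, μ)` is essentially countably generated
    (hA1 : ∃ c : Set (Set T), c.Countable ∧
      ‹MeasurableSpace T› = MeasurableSpace.generateFrom (c ∪ {s : Set T | μ s = 0}))
    -- the graphon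
    (W : T → T → ℝ) (hWmeas : Measurable (Function.uncurry W))
    (hW01 : ∀ t s, W t s ∈ Set.Icc (0 : ℝ) 1)
    -- (A2) the strategy correspondence is nonempty, convex and weakly compact valued
    (S : T → Set E)
    (hSne : ∀ t, (S t).Nonempty)
    (hSconv : ∀ t, Convex ℝ (S t))
    (hScomp : ∀ t, IsCompact (toWeakSpace ℝ E '' S t))
    -- (A3) `S` is graph measurable and integrably bounded
    (hSgraph : MeasurableSet {p : T × E | p.2 ∈ S p.1})
    (hSbdd : ∃ φ : T → ℝ, Integrable φ μ ∧ ∀ᵐ t ∂μ, ∀ a ∈ S t, ‖a‖ ≤ φ t)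
    -- the utility function
    (U : T → E → E → ℝ)
    -- (A4) weak continuity
    (hA4 : ∀ t, ContinuousOn
      (fun p : WeakSpace ℝ E × WeakSpace ℝ E =>
        U t ((toWeakSpace ℝ E).symm p.1) ((toWeakSpace ℝ E).symm p.2))
      ((toWeakSpace ℝ E '' S t) ×ˢ (Set.univ : Set (WeakSpace ℝ E))))
    -- (A5) quasi-concavity
    (hA5 : ∀ t e, QuasiconcaveOn ℝ (S t) (fun a => U t a e))
    -- (A6) measurability
    (hA6 : ∀ e : E, Measurable (fun p : {q : T × E // q.2 ∈ S q.1} => U p.1.1 p.1.2 e))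
    -- the sequences and their limits, all integrable selections of `S`
    (f g : T → E) (fn gn : ℕ → T → E)
    (hfInt : Integrable f μ) (hgInt : Integrable g μ)
    (hfnInt : ∀ n, Integrable (fn n) μ) (hgnInt : ∀ n, Integrable (gn n) μ)
    (hfSel : ∀ᵐ t ∂μ, f t ∈ S t) (hgSel : ∀ᵐ t ∂μ, g t ∈ S t)
    (hfnSel : ∀ n, ∀ᵐ t ∂μ, fn n t ∈ S t) (hgnSel : ∀ n, ∀ᵐ t ∂μ, gn n t ∈ S t)
    -- `f_n → f` and `g_n → g` in the weak topology of `L¹(μ, E)`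
    (hfweak : Tendsto
      (fun n => toWeakSpace ℝ (Lp E 1 μ) ((hfnInt n).toL1 (fn n))) atTop
      (𝓝 (toWeakSpace ℝ (Lp E 1 μ) (hfInt.toL1 f))))
    (hgweak : Tendsto
      (fun n => toWeakSpace ℝ (Lp E 1 μ) ((hgnInt n).toL1 (gn n))) atTop
      (𝓝 (toWeakSpace ℝ (Lp E 1 μ) (hgInt.toL1 g))))
    -- for every `n`, `f_n(t) ∈ B(t, 𝕎(t, g_n))` for a.e. `t`
    (hBR : ∀ n, ∀ᵐ t ∂μ, fn n t ∈ S t ∧ ∀ a ∈ S t,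
      U t a (∫ s, W t s • gn n s ∂μ) ≤ U t (fn n t) (∫ s, W t s • gn n s ∂μ)) :
    -- conclusion: `f(t) ∈ B(t, 𝕎(t, g))` for a.e. `t`
    ∀ᵐ t ∂μ, f t ∈ S t ∧ ∀ a ∈ S t,
      U t a (∫ s, W t s • g s ∂μ) ≤ U t (f t) (∫ s, W t s • g s ∂μ) := by
  filter_upwards [ae_exists_tendsto_convexHull_of_tendsto_weakSpace_L1 hfInt hfnInt hfweak,
    ae_all_iff.2 hBR] with t ⟨v, hv, hvf⟩ ht
  exact mem_argmax_of_tendsto_convexHull (hSconv t) (hScomp t) (hA4 t) (hA5 t _)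
    (tendsto_weakSpace_integral_smul hWmeas.of_uncurry_left (hW01 t) hgInt hgnInt hgweak)
    ht hv hvf
end
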